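/- arXiv:math/0703549 — 2 statements merged into one kernel-verified Lean document; each statement's English description precedes it below -/
import Mathlib

section
/- Let p be the characteristic of 𝔽_q and let γ : k̄ → k̄ be the map γ(t) = t + 1 (an element of order p). For every integer n ≥ 1, the number of (np)-element subsets S ⊆ k̄ with σ(S) = S and γ(S) = S equals the number of n-element subsets T ⊆ k̄ with σ(T) = T, namely q if n = 1 and q^n − q^{n−1} if n ≥ 2. -/
noncomputable section

open Polynomial

namespace Hyp

attribute [local instance] Classical.propDecidable Classical.decEq

variable (F : Type) [Field F] [Fintype F]

/-- The embedding of `F` into its algebraic closure. -/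
def em : F →+* AlgebraicClosure F := algebraMap F (AlgebraicClosure F)

/-- The Frobenius `t ↦ t^q` acting on `P¹(k̄) = k̄ ∪ {∞}`, where `∞ = none`. -/
def frobP1 : Option (AlgebraicClosure F) → Option (AlgebraicClosure F) :=
  Option.map fun x => x ^ Fintype.card F

variable {F}

/-- The Möbius action of a `2×2` matrix `(a b; c d)` over `F` on `P¹(k̄) = k̄ ∪ {∞}`:
`t ↦ (at+b)/(ct+d)`, with the usual conventions at `∞` and at poles. -/
def moebius (γ : Matrix (Fin 2) (Fin 2) F) :
    Option (AlgebraicClosure F) → Option (AlgebraicClosure F)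
  | none =>
      if γ 1 0 = 0 then none else some (em F (γ 0 0) / em F (γ 1 0))
  | some x =>
      if em F (γ 1 0) * x + em F (γ 1 1) = 0 then none
      else some ((em F (γ 0 0) * x + em F (γ 0 1)) / (em F (γ 1 0) * x + em F (γ 1 1)))

/-- The local multiplier `j(γ,t)`. -/
def locMult (γ : Matrix (Fin 2) (Fin 2) F) :
    Option (AlgebraicClosure F) → AlgebraicClosure F
  | none => if γ 1 0 = 0 then em F (γ 1 1) else em F (-γ.det / γ 1 0)
  | some x =>
      if em F (γ 1 0) * x + em F (γ 1 1) = 0 then em F (γ 1 0)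
      else em F γ.det / (em F (γ 1 0) * x + em F (γ 1 1))

/-- The global multiplier `J(γ,S) = ∏_{t ∈ S} j(γ,t)`. -/
def Jmult (γ : Matrix (Fin 2) (Fin 2) F) (S : Finset (Option (AlgebraicClosure F))) :
    AlgebraicClosure F :=
  ∏ t ∈ S, locMult γ t

/-- `S` is a rational `n`-set of `P¹`: it has `n` elements and is Frobenius-stable. -/
def IsRatSet (n : ℕ) (S : Finset (Option (AlgebraicClosure F))) : Prop :=
  S.card = n ∧ S.image (frobP1 F) = S

/-- `m` is the order of `γ` in `PGL₂(F)`: the least positive integer such that `γ^m`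
is a scalar matrix. -/
def IsPGLOrder (γ : Matrix (Fin 2) (Fin 2) F) (m : ℕ) : Prop :=
  IsLeast {n : ℕ | 0 < n ∧ ∃ lam : F, γ ^ n = lam • (1 : Matrix (Fin 2) (Fin 2) F)} m

/-- `J(γ,S)` is a square in `F*`. -/
def IsSquareJ (γ : Matrix (Fin 2) (Fin 2) F) (S : Finset (Option (AlgebraicClosure F))) : Prop :=
  ∃ v : F, v ≠ 0 ∧ Jmult γ S = em F (v * v)

/-- The monic polynomial `f_S(x) = ∏_{t ∈ S, t ≠ ∞} (x - t)` attached to a finite subset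
of `P¹(k̄)`. -/
def fpoly (S : Finset (Option (AlgebraicClosure F))) : Polynomial (AlgebraicClosure F) :=
  ∏ t ∈ S, t.elim 1 fun a => X - C a

/-- `t` belongs to `P¹(F) = F ∪ {∞}` inside `P¹(k̄)`. -/
def inP1k (t : Option (AlgebraicClosure F)) : Prop :=
  t = none ∨ ∃ x : F, t = some (em F x)

/-- `t` belongs to `P¹(𝔽_{q²})` inside `P¹(k̄)`. -/
def inP1k2 [Fintype F] (t : Option (AlgebraicClosure F)) : Prop :=
  t = none ∨ ∃ x : AlgebraicClosure F, x ^ Fintype.card F ^ 2 = x ∧ t = some x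

section StableMultisets

variable {α : Type*} (f : α → α)

/-- The multisets of size `n` that are stable under `f`. -/
def stableMultisets (n : ℕ) : Set (Multiset α) :=
  {M | M.card = n ∧ M.map f = M}

/-- The multisets of size `n` without repetition that are stable under `f`. -/
def stableNodupMultisets (n : ℕ) : Set (Multiset α) :=
  {M | M ∈ stableMultisets f n ∧ M.Nodup}

variable {f}

theorem image_eq_self_iff_val [DecidableEq α] (hf : f.Injective) (S : Finset α) :
    S.image f = S ↔ S.val.map f = S.val := by
  rw [← Finset.val_inj, Finset.image_val_of_injOn hf.injOn]

theorem image_eq_self_iff_forall [DecidableEq α] (hf : f.Injective) (S : Finset α) :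
    S.image f = S ↔ ∀ x, f x ∈ S ↔ x ∈ S := by
  constructor
  · intro h x
    conv_lhs => rw [← h]
    simp [hf.eq_iff]
  · intro h
    exact Finset.eq_of_subset_of_card_le
      (Finset.image_subset_iff.2 fun x hx => (h x).2 hx)
      (Finset.card_image_of_injective S hf).ge

theorem ncard_stableFinsets [DecidableEq α] (hf : f.Injective) (n : ℕ) :
    {S : Finset α | S.card = n ∧ S.image f = S}.ncard = (stableNodupMultisets f n).ncard := by
  rw [← Set.InjOn.ncard_image (f := Finset.val) Finset.val_injective.injOn]
  congr 1
  ext M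
  constructor
  · rintro ⟨S, ⟨hc, hS⟩, rfl⟩
    exact ⟨⟨hc, (image_eq_self_iff_val hf S).1 hS⟩, S.nodup⟩
  · rintro ⟨⟨hc, hM⟩, hn⟩
    exact ⟨⟨M, hn⟩, ⟨hc, (image_eq_self_iff_val hf _).2 hM⟩, rfl⟩

theorem map_eq_self_iff_count [DecidableEq α] (hf : f.Bijective) (M : Multiset α) :
    M.map f = M ↔ ∀ x, M.count (f x) = M.count x := by
  rw [Multiset.ext, hf.surjective.forall]
  simp only [Multiset.count_map_eq_count' f M hf.injective, eq_comm]

theorem add_two_nsmul_injective {a a' b b' : Multiset α} (ha : a.Nodup) (ha' : a'.Nodup)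
    (h : a + 2 • b = a' + 2 • b') : a = a' ∧ b = b' := by
  classical
  have key : ∀ x, a.count x = a'.count x ∧ b.count x = b'.count x := by
    intro x
    have h1 := congrArg (Multiset.count x) h
    have h2 := Multiset.nodup_iff_count_le_one.1 ha x
    have h3 := Multiset.nodup_iff_count_le_one.1 ha' x
    simp only [Multiset.count_add, Multiset.count_nsmul] at h1
    omega
  exact ⟨Multiset.ext.2 fun x => (key x).1, Multiset.ext.2 fun x => (key x).2⟩

theorem exists_eq_add_two_nsmul (hf : f.Bijective) {M : Multiset α} (hM : M.map f = M) :
    ∃ a b : Multiset α, a.Nodup ∧ a.map f = a ∧ b.map f = b ∧ a + 2 • b = M := by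
  classical
  rw [map_eq_self_iff_count hf] at hM
  have hcount (g : ℕ → ℕ) (hg : g 0 = 0) : ∃ a : Multiset α, ∀ x, a.count x = g (M.count x) :=
    ⟨Multiset.toFinsupp.symm (Finsupp.mapRange g hg (Multiset.toFinsupp M)), fun x => by
      rw [← Multiset.toFinsupp_apply]; simp⟩
  obtain ⟨a, ha⟩ := hcount (· % 2) rfl
  obtain ⟨b, hb⟩ := hcount (· / 2) rfl
  refine ⟨a, b, Multiset.nodup_iff_count_le_one.2 fun x => ?_,
    (map_eq_self_iff_count hf a).2 fun x => ?_, (map_eq_self_iff_count hf b).2 fun x => ?_,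
    Multiset.ext.2 fun x => ?_⟩
  · rw [ha]; omega
  · rw [ha, ha, hM]
  · rw [hb, hb, hM]
  · rw [Multiset.count_add, Multiset.count_nsmul, ha, hb]; omega

theorem ncard_stableMultisets_eq_sum (hf : f.Bijective)
    (hfin : ∀ n, (stableMultisets f n).Finite) (n : ℕ) :
    (stableMultisets f n).ncard = ∑ j ∈ Finset.range (n / 2 + 1),
      (stableNodupMultisets f (n - 2 * j)).ncard * (stableMultisets f j).ncard := by
  have hfin' (m) : Finite (stableMultisets f m) := (hfin m).to_subtype
  have hfin'' (m) : Finite (stableNodupMultisets f m) :=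
    ((hfin m).subset fun _ h => h.1).to_subtype
  let T := Σ j : Fin (n / 2 + 1), stableNodupMultisets f (n - 2 * j) × stableMultisets f j
  let e : T → stableMultisets f n := fun t =>
    ⟨t.2.1.1 + 2 • t.2.2.1, by
      have ha := t.2.1.2.1
      have hb := t.2.2.2
      refine ⟨?_, ?_⟩
      · rw [Multiset.card_add, Multiset.card_nsmul, ha.1, hb.1]
        have := t.1.2
        omega
      · rw [Multiset.map_add, Multiset.map_nsmul, ha.2, hb.2]⟩
  have he : e.Bijective := by
    constructor
    · rintro ⟨j, ⟨a, ha⟩, b, hb⟩ ⟨j', ⟨a', ha'⟩, b', hb'⟩ h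
      obtain ⟨rfl, rfl⟩ := add_two_nsmul_injective ha.2 ha'.2 (congrArg Subtype.val h)
      obtain rfl : j = j' := Fin.ext (hb.1.symm.trans hb'.1)
      rfl
    · rintro ⟨M, hc, hM⟩
      obtain ⟨a, b, ha, haf, hbf, rfl⟩ := exists_eq_add_two_nsmul hf hM
      rw [Multiset.card_add, Multiset.card_nsmul] at hc
      exact ⟨⟨⟨b.card, by omega⟩, ⟨a, ⟨by dsimp only; omega, haf⟩, ha⟩, b, rfl, hbf⟩, rfl⟩
  rw [← Nat.card_coe_set_eq, ← Nat.card_eq_of_bijective e he, Nat.card_sigma,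
    Finset.sum_range]
  simp [Nat.card_prod, Nat.card_coe_set_eq]

theorem ncard_stableNodupMultisets (hf : f.Bijective) {q : ℕ} (hq : 0 < q)
    (hcard : ∀ n, (stableMultisets f n).ncard = q ^ n) :
    (stableNodupMultisets f 1).ncard = q ∧
      ∀ n, 2 ≤ n → (stableNodupMultisets f n).ncard = q ^ n - q ^ (n - 1) := by
  have hfin (n) : (stableMultisets f n).Finite :=
    Set.finite_of_ncard_pos (by rw [hcard]; positivity)
  have hsum (n) := ncard_stableMultisets_eq_sum hf hfin n
  simp only [hcard] at hsum
  refine ⟨by simpa using (hsum 1).symm, fun n hn => ?_⟩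
  obtain ⟨m, rfl⟩ := Nat.exists_eq_add_of_le' hn
  have h := hsum (m + 2)
  rw [show (m + 2) / 2 + 1 = m / 2 + 1 + 1 by omega, Finset.sum_range_succ'] at h
  have h' : ∑ j ∈ Finset.range (m / 2 + 1),
      (stableNodupMultisets f (m + 2 - 2 * (j + 1))).ncard * q ^ (j + 1) = q ^ (m + 1) := by
    rw [pow_succ, hsum m, Finset.sum_mul]
    refine Finset.sum_congr rfl fun j _ => ?_
    rw [show m + 2 - 2 * (j + 1) = m - 2 * j by omega, pow_succ, mul_assoc]
  rw [h'] at h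
  simp only [mul_zero, pow_zero, mul_one, Nat.sub_zero] at h
  rw [show m + 2 - 1 = m + 1 by omega]
  omega

end StableMultisets

section FrobeniusStable

theorem ncard_monic_natDegree (n : ℕ) :
    {g : F[X] | g.Monic ∧ g.natDegree = n}.ncard = Fintype.card F ^ n := by
  rw [← Nat.card_coe_set_eq]
  refine (Nat.card_congr ((monicEquivDegreeLT n).trans (degreeLTEquiv F n).toEquiv)).trans ?_
  simp

theorem mem_range_algebraMap_iff_pow_card {K : Type*} [Field K] [Algebra F K] {x : K} :
    x ∈ Set.range (algebraMap F K) ↔ x ^ Fintype.card F = x := by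
  constructor
  · rintro ⟨a, rfl⟩
    rw [← map_pow, FiniteField.pow_card]
  · intro h
    have hs : (X ^ Fintype.card F - X : F[X]).Splits := by
      rw [splits_iff_card_roots, FiniteField.roots_X_pow_card_sub_X,
        FiniteField.X_pow_card_sub_X_natDegree_eq F Fintype.one_lt_card]
      rfl
    have hne := FiniteField.X_pow_card_sub_X_ne_zero K (Fintype.one_lt_card (α := F))
    have hr := hs.roots_map (algebraMap F K)
    rw [FiniteField.roots_X_pow_card_sub_X] at hr
    have hx : x ∈ (map (algebraMap F K) (X ^ Fintype.card F - X : F[X])).roots := by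
      simpa [sub_eq_zero, h] using hne
    rw [hr] at hx
    simpa using hx

theorem ncard_stableMultisets_frobenius (n : ℕ) :
    (stableMultisets (fun x : AlgebraicClosure F => x ^ Fintype.card F) n).ncard =
      Fintype.card F ^ n := by
  rw [← ncard_monic_natDegree (F := F)]
  symm
  let i := algebraMap F (AlgebraicClosure F)
  let φ := (FiniteField.frobeniusAlgHom F (AlgebraicClosure F)).toRingHom
  have hφi : φ.comp i = i := (FiniteField.frobeniusAlgHom F (AlgebraicClosure F)).comp_algebraMap
  refine Set.ncard_congr (fun g _ => (g.map i).roots) ?_ ?_ ?_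
  · rintro g ⟨hg, rfl⟩
    have hs := IsAlgClosed.splits (g.map i)
    refine ⟨by rw [← hs.natDegree_eq_card_roots, natDegree_map], ?_⟩
    change (g.map i).roots.map φ = _
    rw [← hs.roots_map φ, map_map, hφi]
  · rintro g g' ⟨hg, -⟩ ⟨hg', -⟩ h
    apply map_injective i i.injective
    rw [(IsAlgClosed.splits (g.map i)).eq_prod_roots_of_monic (hg.map i),
      (IsAlgClosed.splits (g'.map i)).eq_prod_roots_of_monic (hg'.map i), h]
  · rintro M ⟨hc, hM⟩
    let P := (M.map fun a => X - C a).prod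
    have hP : P.Monic := monic_multiset_prod_of_monic _ _ fun a _ => monic_X_sub_C a
    have hPφ : P.map φ = P := by
      change M.map φ = M at hM
      simp only [P]
      conv_rhs => rw [← hM]
      rw [Polynomial.map_multiset_prod]
      simp [Multiset.map_map]
    have hl : P ∈ lifts i := by
      rw [lifts_iff_coeff_lifts]
      intro k
      rw [mem_range_algebraMap_iff_pow_card]
      conv_rhs => rw [← hPφ]
      rw [coeff_map]
      rfl
    obtain ⟨g, hg, hd, hm⟩ := lifts_and_natDegree_eq_and_monic hl hP
    refine ⟨g, ⟨hm, ?_⟩, ?_⟩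
    · rw [hd, natDegree_multiset_prod_X_sub_C_eq_card, hc]
    · rw [hg, roots_multiset_prod_X_sub_C]

end FrobeniusStable

section ArtinSchreier

variable {K : Type*} [Field K] (p : ℕ) [Fact p.Prime] [CharP K p]

theorem add_one_pow_sub (x : K) : (x + 1) ^ p - (x + 1) = x ^ p - x := by
  rw [add_pow_char, one_pow]; ring

theorem pow_sub_eq_iff {x y : K} : y ^ p - y = x ^ p - x ↔ ∃ k : ℤ, y = x + k := by
  have : y ^ p - y = x ^ p - x ↔ (y - x) ^ p = y - x := by
    rw [sub_pow_char]
    constructor <;> intro h <;> linear_combination h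
  rw [this, ← Subfield.mem_bot_iff_pow_eq_self K p, mem_bot_iff_intCast p K]
  exact exists_congr fun k => by rw [eq_comm, sub_eq_iff_eq_add']

theorem card_fiber_pow_sub [DecidableEq K] [IsAlgClosed K] (t : K) :
    ∃ A : Finset K, A.card = p ∧ ∀ x, x ∈ A ↔ x ^ p - x = t := by
  have hp := (Fact.out : p.Prime).one_lt
  have hd : (X ^ p - X - C t : K[X]).natDegree = p := by
    rw [natDegree_sub_C, FiniteField.X_pow_card_sub_X_natDegree_eq K hp]
  have h0 : (X ^ p - X - C t : K[X]) ≠ 0 := by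
    rintro h
    rw [h, natDegree_zero] at hd
    omega
  have hs : (X ^ p - X - C t : K[X]).Separable := by
    refine ⟨0, -1, ?_⟩
    simp [derivative_X_pow]
  refine ⟨(X ^ p - X - C t : K[X]).roots.toFinset, ?_, fun x => ?_⟩
  · rw [Multiset.toFinset_card_of_nodup (nodup_roots hs),
      ← (IsAlgClosed.splits _).natDegree_eq_card_roots, hd]
  · simp [h0, sub_eq_zero]

end ArtinSchreier

/-- Pulling back along the Artin–Schreier map `x ↦ x ^ p - x` identifies the Frobenius-stable sets
of size `n` with the Frobenius- and translation-stable sets of size `n * p`. -/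
theorem ncard_frobenius_translation_stable (n : ℕ) :
    {S : Finset (AlgebraicClosure F) |
      S.card = n * ringChar F ∧ S.image (fun x => x ^ Fintype.card F) = S ∧
        S.image (fun x => x + 1) = S}.ncard =
    {T : Finset (AlgebraicClosure F) |
      T.card = n ∧ T.image (fun x => x ^ Fintype.card F) = T}.ncard := by
  set p := ringChar F
  have : Fact p.Prime := ⟨CharP.char_is_prime F p⟩
  have : CharP (AlgebraicClosure F) p :=
    charP_of_injective_algebraMap (algebraMap F (AlgebraicClosure F)).injective p
  have hp := (Fact.out : p.Prime).pos
  let w : AlgebraicClosure F → AlgebraicClosure F := fun x => x ^ p - x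
  have hfrob : (fun x : AlgebraicClosure F => x ^ Fintype.card F).Injective :=
    (FiniteField.frobeniusAlgHom F (AlgebraicClosure F)).toRingHom.injective
  have hwfrob (x : AlgebraicClosure F) : w (x ^ Fintype.card F) = w x ^ Fintype.card F := by
    have := (FiniteField.frobeniusAlgHom F (AlgebraicClosure F)).map_sub (x ^ p) x
    change (x ^ p - x) ^ _ = (x ^ p) ^ _ - x ^ _ at this
    simp only [w, this, pow_right_comm]
  have hw1 (x : AlgebraicClosure F) : w (x + 1) = w x := add_one_pow_sub p x
  choose fib hfib hmem using card_fiber_pow_sub (K := AlgebraicClosure F) p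
  have hwsurj : w.Surjective := fun t => by
    obtain ⟨x, hx⟩ := Finset.card_pos.1 ((hfib t).symm ▸ hp)
    exact ⟨x, (hmem t x).1 hx⟩
  let pre : Finset (AlgebraicClosure F) → Finset (AlgebraicClosure F) := fun T => T.biUnion fib
  have hpre (T : Finset (AlgebraicClosure F)) (x : AlgebraicClosure F) : x ∈ pre T ↔ w x ∈ T := by
    simp [pre, hmem, w]
  have hcard (T : Finset (AlgebraicClosure F)) : (pre T).card = T.card * p := by
    rw [Finset.card_biUnion, Finset.sum_congr rfl fun t _ => hfib t, Finset.sum_const, smul_eq_mul]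
    intro t _ t' _ hne
    refine Finset.disjoint_left.2 fun x hx hx' => hne ?_
    rw [← (hmem t x).1 hx, ← (hmem t' x).1 hx']
  have hinj : pre.Injective := fun T T' h => by
    ext t
    obtain ⟨x, rfl⟩ := hwsurj t
    rw [← hpre, ← hpre, h]
  refine Eq.trans ?_ (Set.InjOn.ncard_image (f := pre) hinj.injOn)
  congr 1
  ext S
  have hfrobStable (S : Finset (AlgebraicClosure F)) :
      S.image (fun x => x ^ Fintype.card F) = S ↔ ∀ x, x ^ Fintype.card F ∈ S ↔ x ∈ S :=
    image_eq_self_iff_forall hfrob S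
  have htransStable (S : Finset (AlgebraicClosure F)) :
      S.image (fun x => x + 1) = S ↔ ∀ x, x + 1 ∈ S ↔ x ∈ S :=
    image_eq_self_iff_forall (add_left_injective (1 : AlgebraicClosure F)) S
  simp only [Set.mem_ofPred_eq, Set.mem_image, hfrobStable, htransStable]
  constructor
  · rintro ⟨hc, hS, hS1⟩
    have hSint (k : ℤ) : ∀ x : AlgebraicClosure F, x + k ∈ S ↔ x ∈ S := by
      induction k using Int.induction_on with
      | zero => simp
      | succ k ih => intro x; rw [← ih x, ← hS1 (x + (k : ℤ))]; push_cast; rw [add_assoc]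
      | pred k ih => intro x; rw [← ih x, ← hS1 (x + _)]; push_cast; ring_nf
    have hpS : pre (S.image w) = S := by
      ext x
      rw [hpre, Finset.mem_image]
      constructor
      · rintro ⟨y, hy, hyx⟩
        obtain ⟨k, rfl⟩ := (pow_sub_eq_iff p).1 hyx
        exact (hSint k x).1 hy
      · exact fun hx => ⟨x, hx, rfl⟩
    refine ⟨S.image w, ⟨?_, hwsurj.forall.2 fun x => ?_⟩, hpS⟩
    · rw [← hpS, hcard] at hc
      exact Nat.eq_of_mul_eq_mul_right hp hc
    · rw [← hwfrob, ← hpre, ← hpre, hpS, hS]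
  · rintro ⟨T, ⟨hc, hT⟩, rfl⟩
    refine ⟨by rw [hcard, hc], fun x => ?_, fun x => ?_⟩
    · rw [hpre, hpre, hwfrob, hT]
    · rw [hpre, hpre, hw1]

theorem stmt15 {F : Type} [Field F] [Fintype F] (hq : Odd (Fintype.card F))
    (n : ℕ) (hn : 1 ≤ n) :
    (n = 1 →
      Set.ncard {S : Finset (AlgebraicClosure F) |
          S.card = n * ringChar F ∧ S.image (fun x => x ^ Fintype.card F) = S ∧
          S.image (fun x => x + 1) = S} = Fintype.card F) ∧
    (2 ≤ n →
      Set.ncard {S : Finset (AlgebraicClosure F) |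
          S.card = n * ringChar F ∧ S.image (fun x => x ^ Fintype.card F) = S ∧
          S.image (fun x => x + 1) = S}
        = Fintype.card F ^ n - Fintype.card F ^ (n - 1)) := by
  rw [ncard_frobenius_translation_stable, ncard_stableFinsets
    (f := fun x : AlgebraicClosure F => x ^ Fintype.card F)
    (FiniteField.frobeniusAlgHom F (AlgebraicClosure F)).toRingHom.injective]
  have h := ncard_stableNodupMultisets (q := Fintype.card F)
    (f := fun x : AlgebraicClosure F => x ^ Fintype.card F)
    (FiniteField.frobeniusAlgEquivOfAlgebraic F (AlgebraicClosure F)).bijective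
    Fintype.card_pos ncard_stableMultisets_frobenius
  exact ⟨fun hn => hn ▸ h.1, h.2 n⟩

end Hyp
end
end

section
/- Let γ ∈ GL₂(𝔽_q) be a matrix whose characteristic polynomial is irreducible over 𝔽_q, let m be the order of γ in PGL₂(𝔽_q), and let Fix_γ = {t₀, σ(t₀)} ⊆ P¹(𝔽_{q²}) ∖ P¹(𝔽_q) be its two fixed points on P¹(k̄). For every integer n ≥ 1, the number of (nm)-element subsets S ⊆ P¹(k̄) ∖ Fix_γ with σ(S) = S and γ(S) = S equals the number of n-element subsets T ⊆ P¹(k̄) ∖ Fix_γ with σ(T) = T, namely (q+1)·(q^{n+1} − q^n − (−1)^{⌈n/2⌉}·q + (−1)^{⌈(n−1)/2⌉})/(q²+1). -/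
noncomputable section

open Polynomial

namespace Hyp

attribute [local instance] Classical.propDecidable Classical.decEq

variable (F : Type) [Field F] [Fintype F]

variable {F}

theorem encard_stable_split {P : Type*} [DecidableEq P] {f : P → P}
    (hf : Function.Injective f) {O : Finset P} (hne : O.Nonempty) (hO : O.image f = O)
    (hdich : ∀ S : Finset P, S.image f = S → O ⊆ S ∨ Disjoint O S) (n : ℕ) :
    {S : Finset P | S.card = n + O.card ∧ S.image f = S}.encard =
      {S : Finset P | S.card = n + O.card ∧ S.image f = S ∧ Disjoint O S}.encard +
      {S : Finset P | S.card = n ∧ S.image f = S ∧ Disjoint O S}.encard := by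
  have himg : {S : Finset P | S.card = n + O.card ∧ S.image f = S ∧ O ⊆ S} =
      (fun S => S ∪ O) '' {S : Finset P | S.card = n ∧ S.image f = S ∧ Disjoint O S} := by
    ext S
    constructor
    · rintro ⟨hc, hS, hOS⟩
      refine ⟨S \ O, ⟨?_, ?_, Finset.disjoint_sdiff⟩, Finset.sdiff_union_of_subset hOS⟩
      · rw [Finset.card_sdiff_of_subset hOS, hc, Nat.add_sub_cancel]
      · rw [Finset.image_sdiff _ _ hf, hS, hO]
    · rintro ⟨T, ⟨hc, hT, hd⟩, rfl⟩
      refine ⟨?_, ?_, Finset.subset_union_right⟩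
      · rw [Finset.card_union_of_disjoint hd.symm, hc]
      · rw [Finset.image_union, hT, hO]
  have hinj : Set.InjOn (fun S => S ∪ O)
      {S : Finset P | S.card = n ∧ S.image f = S ∧ Disjoint O S} := by
    rintro S ⟨-, -, hS⟩ T ⟨-, -, hT⟩ h
    have := congrArg (· \ O) h
    simpa [Finset.union_sdiff_right, Finset.sdiff_eq_self_of_disjoint hS.symm,
      Finset.sdiff_eq_self_of_disjoint hT.symm] using this
  rw [← hinj.encard_image, ← himg, ← Set.encard_union_eq]
  · congr 1
    ext S
    constructor
    · rintro ⟨hc, hS⟩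
      rcases hdich S hS with h | h
      · exact Or.inr ⟨hc, hS, h⟩
      · exact Or.inl ⟨hc, hS, h⟩
    · rintro (⟨hc, hS, -⟩ | ⟨hc, hS, -⟩) <;> exact ⟨hc, hS⟩
  · rw [Set.disjoint_left]
    rintro S ⟨-, -, h⟩ ⟨-, -, h'⟩
    obtain ⟨x, hx⟩ := hne
    exact Finset.disjoint_left.mp h hx (h' hx)

theorem encard_stable_map {G P : Type*} [DecidableEq G] [DecidableEq P] (V : G ↪ P)
    {f g : P → P} {f' g' : G → G} (hf : ∀ u, f (V u) = V (f' u)) (hg : ∀ u, g (V u) = V (g' u))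
    (n : ℕ) :
    {S : Finset P | S.card = n ∧ (∀ t ∈ S, t ∈ Set.range V) ∧
      S.image f = S ∧ S.image g = S}.encard =
    {S : Finset G | S.card = n ∧ S.image f' = S ∧ S.image g' = S}.encard := by
  have key : ∀ {h : P → P} {h' : G → G}, (∀ u, h (V u) = V (h' u)) → ∀ S : Finset G,
      (S.map V).image h = S.map V ↔ S.image h' = S := by
    intro h h' hh S
    rw [← Finset.map_inj (f := V) (s₁ := S.image h'), Finset.map_eq_image V (S.image h'),
      Finset.map_eq_image V S, Finset.image_image, Finset.image_image]
    have : h ∘ V = V ∘ h' := funext hh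
    rw [this]
  rw [← (Finset.map_injective V).encard_image]
  congr 1
  ext S
  constructor
  · rintro ⟨hc, hr, h1, h2⟩
    have hS : (S.preimage V V.injective.injOn).map V = S := by
      ext t
      simp only [Finset.mem_map, Finset.mem_preimage]
      exact ⟨by rintro ⟨u, hu, rfl⟩; exact hu, fun ht => by
        obtain ⟨u, rfl⟩ := hr t ht; exact ⟨u, ht, rfl⟩⟩
    refine ⟨S.preimage V V.injective.injOn, ⟨?_, ?_, ?_⟩, hS⟩
    · rw [← Finset.card_map V, hS, hc]
    · rw [← key hf, hS, h1]
    · rw [← key hg, hS, h2]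
  · rintro ⟨T, ⟨hc, h1, h2⟩, rfl⟩
    refine ⟨by rw [Finset.card_map, hc], ?_, (key hf T).2 h1, (key hg T).2 h2⟩
    simp only [Finset.mem_map]
    rintro t ⟨u, -, rfl⟩
    exact ⟨u, rfl⟩

open scoped Pointwise in
theorem image_mul_zpow_mem {G : Type*} [CommGroup G] [DecidableEq G] {ζ : G} {S : Finset G}
    (hS : S.image (ζ * ·) = S) {x z : G} (hx : x ∈ S) (hz : z ∈ Subgroup.zpowers ζ) :
    z * x ∈ S := by
  have hiff : ∀ y, ζ * y ∈ S ↔ y ∈ S := fun y => by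
    conv_lhs => rw [← hS]
    simp
  have : Subgroup.zpowers ζ ≤ MulAction.stabilizer G (S : Set G) := by
    rw [Subgroup.zpowers_le, MulAction.mem_stabilizer_set]
    intro y
    simpa using hiff y
  have h := (MulAction.mem_stabilizer_set.1 (this hz) x).2 hx
  simpa using h

theorem encard_stable_quotient {G : Type*} [CommGroup G] [DecidableEq G] {m : ℕ} (hm : 0 < m)
    {ζ : G} (hord : orderOf ζ = m) (hker : ∀ x : G, x ^ m = 1 → x ∈ Subgroup.zpowers ζ)
    (hsurj : Function.Surjective fun x : G => x ^ m) (φ : G →* G) (hφ : Function.Injective φ)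
    (n : ℕ) :
    {S : Finset G | S.card = n * m ∧ S.image φ = S ∧ S.image (ζ * ·) = S}.encard =
    {T : Finset G | T.card = n ∧ T.image φ = T}.encard := by
  have hζm : ζ ^ m = 1 := hord ▸ pow_orderOf_eq_one ζ
  have hz : ∀ z ∈ Subgroup.zpowers ζ, z ^ m = 1 := by
    rintro z ⟨i, rfl⟩
    simp only
    rw [← zpow_natCast, ← zpow_mul, mul_comm, zpow_mul, zpow_natCast, hζm, one_zpow]
  have hfib : ∀ x y : G, x ^ m = y ^ m → ∃ z ∈ Subgroup.zpowers ζ, x = z * y := fun x y h =>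
    ⟨x * y⁻¹, hker _ (by rw [mul_pow, inv_pow, h, mul_inv_cancel]), by simp⟩
  have hcard : ∀ y : G, ((Finset.range m).image fun i => ζ ^ i * y).card = m := by
    intro y
    rw [Finset.card_image_of_injOn, Finset.card_range]
    intro i hi j hj h
    have := mul_right_cancel h
    exact pow_injOn_Iio_orderOf (by simpa [hord] using hi) (by simpa [hord] using hj) this
  have hfiber : ∀ S : Finset G, S.image (ζ * ·) = S → ∀ y ∈ S,
      S.filter (fun x => x ^ m = y ^ m) = (Finset.range m).image fun i => ζ ^ i * y := by
    intro S hS y hy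
    ext x
    simp only [Finset.mem_filter, Finset.mem_image, Finset.mem_range]
    constructor
    · rintro ⟨-, h⟩
      obtain ⟨z, hz', rfl⟩ := hfib x y h
      have hfin : IsOfFinOrder ζ := by rw [← orderOf_pos_iff, hord]; exact hm
      rw [hfin.mem_zpowers_iff_mem_range_orderOf, hord] at hz'
      obtain ⟨i, hi, rfl⟩ := Finset.mem_image.1 hz'
      exact ⟨i, Finset.mem_range.1 hi, rfl⟩
    · rintro ⟨i, -, rfl⟩
      have hi : ζ ^ i ∈ Subgroup.zpowers ζ := Subgroup.npow_mem_zpowers ζ i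
      exact ⟨image_mul_zpow_mem hS hy hi, by rw [mul_pow, hz _ hi, one_mul]⟩
  have hcardS : ∀ S : Finset G, S.image (ζ * ·) = S → S.card = (S.image (· ^ m)).card * m := by
    intro S hS
    rw [Finset.card_eq_sum_card_image (· ^ m) S, Finset.sum_const_nat (m := m)]
    intro b hb
    obtain ⟨y, hy, rfl⟩ := Finset.mem_image.1 hb
    rw [hfiber S hS y hy, hcard]
  have hmem : ∀ S : Finset G, S.image (ζ * ·) = S → ∀ x, x ^ m ∈ S.image (· ^ m) ↔ x ∈ S := by
    intro S hS x
    refine ⟨fun h => ?_, fun h => Finset.mem_image_of_mem _ h⟩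
    obtain ⟨y, hy, hxy⟩ := Finset.mem_image.1 h
    obtain ⟨z, hz', rfl⟩ := hfib x y hxy.symm
    exact image_mul_zpow_mem hS hy hz'
  have hcomm : ∀ S : Finset G, (S.image φ).image (· ^ m) = (S.image (· ^ m)).image φ := by
    intro S
    rw [Finset.image_image, Finset.image_image]
    congr 1
    funext x
    simp
  have hinj : Set.InjOn (fun S : Finset G => S.image (· ^ m))
      {S : Finset G | S.card = n * m ∧ S.image φ = S ∧ S.image (ζ * ·) = S} := by
    rintro S ⟨-, -, hS⟩ T ⟨-, -, hT⟩ h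
    ext x
    rw [← hmem S hS, ← hmem T hT]
    exact Finset.ext_iff.1 h _
  rw [← hinj.encard_image]
  congr 1
  ext T
  constructor
  · rintro ⟨S, ⟨hc, h1, h2⟩, rfl⟩
    refine ⟨?_, ?_⟩
    · rw [hcardS S h2] at hc
      exact Nat.eq_of_mul_eq_mul_right hm hc
    · simp only
      rw [← hcomm, h1]
  · rintro ⟨hc, hT⟩
    choose r hr using hsurj
    let S : Finset G := T.biUnion fun t => (Finset.range m).image fun i => ζ ^ i * r t
    have hSmem : ∀ x, x ∈ S ↔ x ^ m ∈ T := by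
      intro x
      simp only [S, Finset.mem_biUnion, Finset.mem_image, Finset.mem_range]
      constructor
      · rintro ⟨t, ht, i, -, rfl⟩
        rw [mul_pow, hz _ (Subgroup.npow_mem_zpowers ζ i), one_mul]
        simpa [hr t] using ht
      · intro hx
        obtain ⟨z, hz', hxz⟩ := hfib x (r (x ^ m)) (hr (x ^ m)).symm
        have hfin : IsOfFinOrder ζ := by rw [← orderOf_pos_iff, hord]; exact hm
        rw [hfin.mem_zpowers_iff_mem_range_orderOf, hord] at hz'
        obtain ⟨i, hi, rfl⟩ := Finset.mem_image.1 hz'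
        exact ⟨x ^ m, hx, i, Finset.mem_range.1 hi, hxz.symm⟩
    have hSζ : S.image (ζ * ·) = S := by
      refine Finset.eq_of_subset_of_card_le (fun x hx => ?_)
        (Finset.card_image_of_injective _ (mul_right_injective ζ)).ge
      obtain ⟨y, hy, rfl⟩ := Finset.mem_image.1 hx
      rw [hSmem] at hy ⊢
      rwa [mul_pow, hζm, one_mul]
    have hSφ : S.image φ = S := by
      refine Finset.eq_of_subset_of_card_le (fun x hx => ?_)
        (Finset.card_image_of_injective _ hφ).ge
      obtain ⟨y, hy, rfl⟩ := Finset.mem_image.1 hx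
      rw [hSmem] at hy ⊢
      rw [← map_pow, ← hT]
      exact Finset.mem_image_of_mem _ hy
    have hST : S.image (· ^ m) = T := by
      ext t
      constructor
      · intro ht
        obtain ⟨y, hy, rfl⟩ := Finset.mem_image.1 ht
        exact (hSmem y).1 hy
      · intro ht
        exact Finset.mem_image.2 ⟨r t, (hSmem _).2 (by simpa [hr t] using ht), hr t⟩
    exact ⟨S, ⟨by rw [hcardS S hSζ, hST, hc], hSφ, hSζ⟩, hST⟩

section
variable {k : Type*} [Field k]

theorem finite_monic_natDegree_eq [Finite k] (n : ℕ) :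
    {f : k[X] | f.Monic ∧ f.natDegree = n}.Finite :=
  Set.finite_coe_iff.1 <|
    Finite.of_equiv _ ((monicEquivDegreeLT (R := k) n).trans (degreeLTEquiv k n).toEquiv).symm

theorem ncard_monic_natDegree_eq [Fintype k] (n : ℕ) :
    {f : k[X] | f.Monic ∧ f.natDegree = n}.ncard = Fintype.card k ^ n := by
  rw [← Nat.card_coe_set_eq]
  have := Nat.card_congr ((monicEquivDegreeLT (R := k) n).trans (degreeLTEquiv k n).toEquiv)
  exact this.trans (by simp)

theorem exists_squarefree_mul_sq (f : k[X]) (hf : f.Monic) :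
    ∃ a b : k[X], a.Monic ∧ b.Monic ∧ Squarefree a ∧ a * b ^ 2 = f := by
  induction hn : f.natDegree using Nat.strong_induction_on generalizing f with
  | _ n ih =>
    by_cases hs : Squarefree f
    · exact ⟨f, 1, hf, monic_one, hs, by simp⟩
    · rw [squarefree_iff_irreducible_sq_not_dvd_of_ne_zero hf.ne_zero] at hs
      push Not at hs
      obtain ⟨x, hx, hxf⟩ := hs
      obtain ⟨y, hy, hyi, hyx⟩ := exists_monic_irreducible_factor x hx.not_isUnit
      obtain ⟨g, rfl⟩ := (mul_dvd_mul hyx hyx).trans hxf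
      have hg : g.Monic := (hy.mul hy).of_mul_monic_left hf
      have hlt : g.natDegree < n := by
        rw [← hn, (hy.mul hy).natDegree_mul hg, hy.natDegree_mul hy]
        have := hyi.natDegree_pos
        omega
      obtain ⟨a, b, ha, hb, has, rfl⟩ := ih _ hlt g hg rfl
      exact ⟨a, y * b, ha, hy.mul hb, has, by ring⟩

theorem squarefree_mul_sq_unique {a b a' b' : k[X]} (hb : b.Monic)
    (hb' : b'.Monic) (hs : Squarefree a) (hs' : Squarefree a')
    (h : a * b ^ 2 = a' * b' ^ 2) : a = a' ∧ b = b' := by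
  obtain ⟨c, c', g, hrel, rfl, rfl⟩ := UniqueFactorizationMonoid.exists_reduced_factors b hb.ne_zero b'
  have hg : g ≠ 0 := left_ne_zero_of_mul hb.ne_zero
  have h2 : a * c ^ 2 = a' * c' ^ 2 := by
    have : g ^ 2 * (a * c ^ 2) = g ^ 2 * (a' * c' ^ 2) := by linear_combination h
    exact mul_left_cancel₀ (pow_ne_zero 2 hg) this
  have hc : IsUnit c := by
    have : c ^ 2 ∣ a' := (hrel.pow (m := 2) (n := 2)).dvd_of_dvd_mul_right (Dvd.intro_left _ h2)
    exact hs' c (by rwa [← sq])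
  have hc' : IsUnit c' := by
    have : c' ^ 2 ∣ a :=
      (hrel.symm.pow (m := 2) (n := 2)).dvd_of_dvd_mul_right (Dvd.intro_left _ h2.symm)
    exact hs c' (by rwa [← sq])
  have hbb : g * c = g * c' := eq_of_monic_of_associated hb hb'
    ((associated_mul_unit_left g c hc).trans (associated_mul_unit_right g c' hc'))
  rw [hbb] at h
  exact ⟨mul_right_cancel₀ (pow_ne_zero 2 hb'.ne_zero) h, hbb⟩

theorem finite_squarefree_natDegree_eq [Finite k] (n : ℕ) :
    {f : k[X] | f.Monic ∧ f.natDegree = n ∧ Squarefree f}.Finite :=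
  (finite_monic_natDegree_eq n).subset fun _ h => ⟨h.1, h.2.1⟩

theorem sum_ncard_squarefree [Fintype k] (n : ℕ) :
    ∑ j ∈ Finset.range (n / 2 + 1),
      {f : k[X] | f.Monic ∧ f.natDegree = n - 2 * j ∧ Squarefree f}.ncard * Fintype.card k ^ j =
      Fintype.card k ^ n := by
  rw [← ncard_monic_natDegree_eq n,
    Set.ncard_eq_toFinset_card _ (finite_monic_natDegree_eq (k := k) n)]
  simp_rw [← ncard_monic_natDegree_eq (k := k),
    Set.ncard_eq_toFinset_card _ (finite_monic_natDegree_eq (k := k) _),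
    Set.ncard_eq_toFinset_card _ (finite_squarefree_natDegree_eq (k := k) _),
    ← Finset.card_product]
  rw [← Finset.card_sigma]
  refine Finset.card_bij (fun x _ => x.2.1 * x.2.2 ^ 2) ?_ ?_ ?_
  · rintro ⟨j, a, b⟩ h
    simp only [Finset.mem_sigma, Finset.mem_range, Finset.mem_product, Set.Finite.mem_toFinset,
      Set.mem_ofPred_eq] at h ⊢
    obtain ⟨hj, ⟨ha, hda, -⟩, hb, hdb⟩ := h
    refine ⟨ha.mul (hb.pow 2), ?_⟩
    rw [ha.natDegree_mul (hb.pow 2), hb.natDegree_pow, hda, hdb]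
    omega
  · rintro ⟨j, a, b⟩ h ⟨j', a', b'⟩ h' heq
    simp only [Finset.mem_sigma, Finset.mem_range, Finset.mem_product, Set.Finite.mem_toFinset,
      Set.mem_ofPred_eq] at h h' heq
    obtain ⟨hj, ⟨ha, hda, has⟩, hb, hdb⟩ := h
    obtain ⟨hj', ⟨ha', hda', has'⟩, hb', hdb'⟩ := h'
    obtain ⟨rfl, rfl⟩ := squarefree_mul_sq_unique hb hb' has has' heq
    rw [← hdb, ← hdb']
  · intro f hf
    simp only [Set.Finite.mem_toFinset, Set.mem_ofPred_eq] at hf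
    obtain ⟨a, b, ha, hb, has, rfl⟩ := exists_squarefree_mul_sq f hf.1
    have hd := hf.2
    rw [ha.natDegree_mul (hb.pow 2), hb.natDegree_pow] at hd
    refine ⟨⟨b.natDegree, a, b⟩, ?_, rfl⟩
    simp only [Finset.mem_sigma, Finset.mem_range, Finset.mem_product, Set.Finite.mem_toFinset,
      Set.mem_ofPred_eq]
    exact ⟨by omega, ⟨ha, by omega, has⟩, hb, trivial⟩

theorem ncard_squarefree_zero [Fintype k] :
    {f : k[X] | f.Monic ∧ f.natDegree = 0 ∧ Squarefree f}.ncard = 1 := by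
  simpa using sum_ncard_squarefree (k := k) 0

theorem ncard_squarefree_one [Fintype k] :
    {f : k[X] | f.Monic ∧ f.natDegree = 1 ∧ Squarefree f}.ncard = Fintype.card k := by
  simpa using sum_ncard_squarefree (k := k) 1

theorem ncard_squarefree_add_two [Fintype k] (n : ℕ) :
    {f : k[X] | f.Monic ∧ f.natDegree = n + 2 ∧ Squarefree f}.ncard + Fintype.card k ^ (n + 1) =
      Fintype.card k ^ (n + 2) := by
  have h := sum_ncard_squarefree (k := k) (n + 2)
  rw [show (n + 2) / 2 + 1 = (n / 2 + 1) + 1 by omega, Finset.sum_range_succ'] at h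
  have h2 : ∑ j ∈ Finset.range (n / 2 + 1), {f : k[X] | f.Monic ∧
      f.natDegree = n + 2 - 2 * (j + 1) ∧ Squarefree f}.ncard * Fintype.card k ^ (j + 1) =
      Fintype.card k ^ (n + 1) := by
    rw [pow_succ (Fintype.card k) n, ← sum_ncard_squarefree n, Finset.sum_mul]
    refine Finset.sum_congr rfl fun j _ => ?_
    rw [show n + 2 - 2 * (j + 1) = n - 2 * j by omega]
    ring
  rw [h2] at h
  simpa [add_comm] using h

theorem mem_range_algebraMap_of_pow_card [Fintype k] {K : Type*} [Field K] [Algebra k K] {x : K}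
    (hx : x ^ Fintype.card k = x) : x ∈ Set.range (algebraMap k K) := by
  have hsp : (X ^ Fintype.card k - X : k[X]).Splits := by
    rw [splits_iff_card_roots, FiniteField.roots_X_pow_card_sub_X,
      FiniteField.X_pow_card_sub_X_natDegree_eq _ Fintype.one_lt_card]
    rfl
  exact hsp.mem_range_of_isRoot
    (FiniteField.X_pow_card_sub_X_ne_zero _ Fintype.one_lt_card) (by simp [hx])

theorem encard_frobenius_stable [Fintype k] {K : Type*} [Field K] [Algebra k K] [IsAlgClosed K]
    [DecidableEq K] (n : ℕ) :
    {S : Finset K | S.card = n ∧ S.image (· ^ Fintype.card k) = S}.encard =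
      {f : k[X] | f.Monic ∧ f.natDegree = n ∧ Squarefree f}.encard := by
  have hsep : ∀ f : k[X], Squarefree f → (f.map (algebraMap k K)).roots.Nodup := fun f hf =>
    nodup_roots (PerfectField.separable_iff_squarefree.2 hf).map
  have hprod : ∀ f : k[X], f.Monic → Squarefree f →
      ∏ t ∈ (f.map (algebraMap k K)).roots.toFinset, (X - C t) = f.map (algebraMap k K) := by
    intro f hf hs
    have := (IsAlgClosed.splits (f.map (algebraMap k K))).eq_prod_roots
    rw [(hf.map _).leadingCoeff, C_1, one_mul] at this
    conv_rhs => rw [this]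
    rw [Finset.prod, Multiset.toFinset_val, (hsep f hs).dedup]
  have hinj : Set.InjOn (fun f : k[X] => (f.map (algebraMap k K)).roots.toFinset)
      {f : k[X] | f.Monic ∧ f.natDegree = n ∧ Squarefree f} := by
    rintro f ⟨hf, -, hfs⟩ g ⟨hg, -, hgs⟩ h
    simp only at h
    apply map_injective _ (algebraMap k K).injective
    rw [← hprod f hf hfs, h, hprod g hg hgs]
  rw [← hinj.encard_image]
  congr 1
  let φ : K →+* K := (FiniteField.frobeniusAlgHom k K : K →+* K)
  have hφ : ∀ x, φ x = x ^ Fintype.card k := fun x => rfl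
  ext S
  constructor
  · rintro ⟨hc, hS⟩
    have hmap : (∏ t ∈ S, (X - C t)).map φ = ∏ t ∈ S, (X - C t) := by
      rw [Polynomial.map_prod]
      conv_rhs => rw [← hS]
      rw [show (fun x : K => x ^ Fintype.card k) = φ from rfl,
        Finset.prod_image fun x _ y _ h => φ.injective h]
      simp [hφ]
    have hlift : (∏ t ∈ S, (X - C t)) ∈ lifts (algebraMap k K) := by
      rw [lifts_iff_coeff_lifts]
      intro i
      apply mem_range_algebraMap_of_pow_card
      rw [← hφ, ← coeff_map, hmap]
    have hmon : (∏ t ∈ S, (X - C t)).Monic := monic_prod_of_monic _ _ fun t _ => monic_X_sub_C t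
    obtain ⟨f, hf, hfd, hfm⟩ := lifts_and_natDegree_eq_and_monic hlift hmon
    refine ⟨f, ⟨hfm, ?_, ?_⟩, ?_⟩
    · rw [hfd, natDegree_prod_of_monic _ _ fun t _ => monic_X_sub_C t]
      simp [hc]
    · rw [← PerfectField.separable_iff_squarefree, ← separable_map (algebraMap k K), hf]
      exact separable_prod_X_sub_C_iff'.2 fun _ _ _ _ h => h
    · simp only
      rw [hf, roots_prod_X_sub_C]
      simp
  · rintro ⟨f, ⟨hf, hd, hs⟩, rfl⟩
    refine ⟨?_, ?_⟩
    · simp only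
      rw [Multiset.toFinset_card_of_nodup (hsep f hs),
        ← (IsAlgClosed.splits _).natDegree_eq_card_roots, natDegree_map, hd]
    · refine Finset.eq_of_subset_of_card_le (fun x hx => ?_)
        (Finset.card_image_of_injective _ φ.injective).ge
      obtain ⟨y, hy, rfl⟩ := Finset.mem_image.1 hx
      rw [Multiset.mem_toFinset, mem_roots (hf.map _).ne_zero, IsRoot.def, eval_map_algebraMap] at hy ⊢
      have h := aeval_algHom_apply (FiniteField.frobeniusAlgHom k K) y f
      rwa [hy, map_zero] at h
end

theorem encard_frobenius_stable_option {k : Type*} [Field k] [Fintype k] {K : Type*} [Field K]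
    [Algebra k K] [IsAlgClosed K] [DecidableEq (Option K)] (n : ℕ) :
    {S : Finset (Option K) | S.card = n + 1 ∧
      S.image (Option.map (· ^ Fintype.card k)) = S}.encard =
      (({f : k[X] | f.Monic ∧ f.natDegree = n + 1 ∧ Squarefree f}.ncard +
        {f : k[X] | f.Monic ∧ f.natDegree = n ∧ Squarefree f}.ncard : ℕ) : ℕ∞) := by
  have hinj : Function.Injective (Option.map fun x : K => x ^ Fintype.card k) :=
    Option.map_injective (FiniteField.frobeniusAlgHom k K).toRingHom.injective
  have hsub : ∀ i, {S : Finset (Option K) | S.card = i ∧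
      S.image (Option.map (· ^ Fintype.card k)) = S ∧ Disjoint {none} S}.encard =
      {f : k[X] | f.Monic ∧ f.natDegree = i ∧ Squarefree f}.encard := by
    intro i
    rw [← encard_frobenius_stable (k := k) (K := K) i]
    have h := encard_stable_map (G := K) (P := Option K) Function.Embedding.some
      (f := Option.map (· ^ Fintype.card k)) (f' := (· ^ Fintype.card k)) (g := id) (g' := id)
      (fun _ => rfl) (fun _ => rfl) i
    simp only [Finset.image_id, and_true] at h
    rw [← h]
    congr 1
    ext S
    simp only [Set.mem_ofPred_eq, Finset.disjoint_singleton_left]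
    have : none ∉ S ↔ ∀ t ∈ S, t ∈ Set.range (Function.Embedding.some : K ↪ Option K) := by
      constructor
      · rintro h (_ | x) ht
        · exact absurd ht h
        · exact ⟨x, rfl⟩
      · intro h hn
        obtain ⟨x, hx⟩ := h _ hn
        cases hx
    rw [this]
    tauto
  have h := encard_stable_split (P := Option K) hinj (O := {none}) (Finset.singleton_nonempty _) (by simp)
    (fun S _ => by
      rw [Finset.singleton_subset_iff, Finset.disjoint_singleton_left]
      exact Classical.em _) n
  rw [Finset.card_singleton, hsub, hsub] at h
  rw [h, Nat.cast_add, (finite_squarefree_natDegree_eq _).cast_ncard_eq,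
    (finite_squarefree_natDegree_eq _).cast_ncard_eq]

theorem count_of_recursion {q : ℕ} {s : ℕ → ℕ} (hs0 : s 0 = 1) (hs1 : s 1 = q)
    (hs : ∀ n, s (n + 2) + q ^ (n + 1) = q ^ (n + 2)) {y : ℕ → ℕ} (hy0 : y 0 = 1)
    (hy1 : y 1 = s 1 + s 0) (hy : ∀ n, y (n + 2) + y n = s (n + 2) + s (n + 1)) (n : ℕ) :
    ((q : ℤ) ^ 2 + 1) * y (n + 1) = ((q : ℤ) + 1) *
      ((q : ℤ) ^ (n + 2) - (q : ℤ) ^ (n + 1) - (-1) ^ ((n + 2) / 2) * (q : ℤ) +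
        (-1) ^ ((n + 1) / 2)) := by
  zify at hs0 hs1 hs hy0 hy1 hy
  induction n using Nat.twoStepInduction with
  | zero => rw [hy1, hs0, hs1]; norm_num; ring
  | one =>
    have h1 := hy 0
    have h2 := hs 0
    norm_num at h1 h2 ⊢
    linear_combination ((q : ℤ) ^ 2 + 1) * (h1 + h2 - hy0 + hs1)
  | more n ih _ =>
    have h1 := hy (n + 1)
    have h2 := hs n
    have h3 := hs (n + 1)
    rw [show (n + 2 + 2) / 2 = (n + 2) / 2 + 1 by omega,
      show (n + 2 + 1) / 2 = (n + 1) / 2 + 1 by omega, pow_succ (-1 : ℤ), pow_succ (-1 : ℤ)]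
    rw [show n + 1 + 2 = n + 2 + 1 by ring, show n + 1 + 1 = n + 2 by ring] at h1 h3
    linear_combination ((q : ℤ) ^ 2 + 1) * (h1 + h2 + h3) - ih

theorem exists_eigenvalue_of_irreducible_charpoly {k : Type*} [Field k] [Fintype k] {K : Type*}
    [Field K] [Algebra k K] [IsAlgClosed K] (γ : Matrix (Fin 2) (Fin 2) k)
    (hirr : Irreducible γ.charpoly) :
    γ 1 0 ≠ 0 ∧ ∃ l l' : K, l ≠ l' ∧ l ^ Fintype.card k = l' ∧ l' ^ Fintype.card k = l ∧
      l + l' = algebraMap k K (γ 0 0) + algebraMap k K (γ 1 1) ∧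
      l * l' = algebraMap k K (γ 0 0) * algebraMap k K (γ 1 1) -
        algebraMap k K (γ 0 1) * algebraMap k K (γ 1 0) := by
  have hdeg : γ.charpoly.natDegree = 2 := by simp [Matrix.charpoly_natDegree_eq_dim]
  have hnr : ∀ x, ¬ γ.charpoly.IsRoot x := fun x hx => by
    have h := degree_eq_one_of_irreducible_of_root hirr hx
    rw [degree_eq_natDegree hirr.ne_zero, hdeg] at h
    norm_num at h
  have hev : ∀ x : K, aeval x γ.charpoly = x ^ 2 - (algebraMap k K (γ 0 0) +
      algebraMap k K (γ 1 1)) * x + (algebraMap k K (γ 0 0) * algebraMap k K (γ 1 1) -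
        algebraMap k K (γ 0 1) * algebraMap k K (γ 1 0)) := fun x => by
    rw [Matrix.charpoly_fin_two, Matrix.trace_fin_two, Matrix.det_fin_two]
    simp
  refine ⟨fun hc => hnr (γ 0 0) ?_, ?_⟩
  · rw [Matrix.charpoly_fin_two, Matrix.trace_fin_two, Matrix.det_fin_two, IsRoot.def, hc]
    simp only [eval_add, eval_sub, eval_pow, eval_mul, eval_X, eval_C]
    ring
  obtain ⟨l, hl⟩ := IsAlgClosed.exists_aeval_eq_zero K γ.charpoly
    (by rw [degree_eq_natDegree hirr.ne_zero, hdeg]; norm_num)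
  have hφ : ∀ x : K, aeval x γ.charpoly = 0 → aeval (x ^ Fintype.card k) γ.charpoly = 0 :=
    fun x hx => by
      have h := aeval_algHom_apply (FiniteField.frobeniusAlgHom k K) x γ.charpoly
      rwa [hx, map_zero] at h
  have hφinj : Function.Injective fun x : K => x ^ Fintype.card k :=
    (FiniteField.frobeniusAlgHom k K).toRingHom.injective
  have hne : l ≠ l ^ Fintype.card k := fun h => by
    obtain ⟨x, rfl⟩ := mem_range_algebraMap_of_pow_card h.symm
    refine hnr x ?_
    rw [aeval_algebraMap_apply] at hl
    exact (algebraMap k K).injective (by simpa using hl)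
  have hsum : ∀ x y : K, x ≠ y → aeval x γ.charpoly = 0 → aeval y γ.charpoly = 0 →
      x + y = algebraMap k K (γ 0 0) + algebraMap k K (γ 1 1) := by
    intro x y hxy hx hy
    rw [hev] at hx hy
    exact mul_left_cancel₀ (sub_ne_zero.2 hxy) (by linear_combination hx - hy)
  have hl' := hφ l hl
  have hs := hsum _ _ hne hl hl'
  have hs' := hsum _ _ (fun h => hne (hφinj h)) hl' (hφ _ hl')
  refine ⟨l, l ^ Fintype.card k, hne, rfl, by linear_combination hs' - hs, hs, ?_⟩
  rw [hev] at hl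
  linear_combination l * hs - hl

/-- The map `u ↦ (t₁ u - t₀) / (u - 1)` from the multiplicative group onto the projective line
with `t₀` and `t₁` removed. -/
def splitTorusParam {K : Type*} [Field K] (t₀ t₁ : K) (u : Kˣ) : Option K :=
  if u = 1 then none else some ((t₁ * u - t₀) / (u - 1))

section
variable {K : Type*} [Field K] {t₀ t₁ : K}

theorem coe_sub_one_ne_zero {u : Kˣ} (hu : u ≠ 1) : (u : K) - 1 ≠ 0 :=
  sub_ne_zero.2 fun h => hu (Units.ext h)

theorem splitTorusParam_injective (h : t₀ ≠ t₁) :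
    Function.Injective (splitTorusParam t₀ t₁) := by
  intro u v huv
  unfold splitTorusParam at huv
  by_cases hu : u = 1 <;> by_cases hv : v = 1
  · rw [hu, hv]
  · simp [hu, hv] at huv
  · simp [hu, hv] at huv
  · rw [if_neg hu, if_neg hv, Option.some_inj,
      div_eq_div_iff (coe_sub_one_ne_zero hu) (coe_sub_one_ne_zero hv)] at huv
    refine Units.ext (mul_left_cancel₀ (sub_ne_zero.2 h) ?_)
    linear_combination huv

theorem mem_range_splitTorusParam (h : t₀ ≠ t₁) (t : Option K) :
    t ∈ Set.range (splitTorusParam t₀ t₁) ↔ t ≠ some t₀ ∧ t ≠ some t₁ := by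
  constructor
  · rintro ⟨u, rfl⟩
    unfold splitTorusParam
    by_cases hu : u = 1
    · simp [hu]
    · have hu' := coe_sub_one_ne_zero hu
      simp only [if_neg hu, ne_eq, Option.some_inj, div_eq_iff hu']
      refine ⟨fun h' => ?_, fun h' => h (by linear_combination -h')⟩
      have : (t₀ - t₁) * u = 0 := by linear_combination -h'
      exact mul_ne_zero (sub_ne_zero.2 h) u.ne_zero this
  · rintro ⟨h0, h1⟩
    rcases t with _ | x
    · exact ⟨1, if_pos rfl⟩
    · have hx0 : x - t₀ ≠ 0 := sub_ne_zero.2 fun h => h0 (congrArg some h)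
      have hx1 : x - t₁ ≠ 0 := sub_ne_zero.2 fun h => h1 (congrArg some h)
      have hval : ((Units.mk0 _ (div_ne_zero hx0 hx1) : Kˣ) : K) = (x - t₀) / (x - t₁) := rfl
      have hne : Units.mk0 _ (div_ne_zero hx0 hx1) ≠ 1 := fun h' => by
        have := congrArg Units.val h'
        rw [hval, Units.val_one, div_eq_one_iff_eq hx1] at this
        exact h (by linear_combination -this)
      refine ⟨_, (if_neg hne).trans ?_⟩
      have h2 := coe_sub_one_ne_zero hne
      rw [Option.some_inj, div_eq_iff h2, hval]
      field_simp
      ring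

end

/-- The twisted Frobenius `u ↦ u⁻ᵠ` on the multiplicative group. -/
def twistedFrobenius (K : Type*) [Field K] (q : ℕ) : Kˣ →* Kˣ where
  toFun u := (u ^ q)⁻¹
  map_one' := by simp
  map_mul' u v := by rw [mul_pow, mul_inv]

theorem splitTorusParam_frobP1 {F : Type} [Field F] [Fintype F] {t₀ t₁ : AlgebraicClosure F}
    (h01 : t₀ ^ Fintype.card F = t₁) (h10 : t₁ ^ Fintype.card F = t₀)
    (u : (AlgebraicClosure F)ˣ) :
    frobP1 F (splitTorusParam t₀ t₁ u) =
      splitTorusParam t₀ t₁ (twistedFrobenius _ (Fintype.card F) u) := by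
  let φ := (FiniteField.frobeniusAlgHom F (AlgebraicClosure F)).toRingHom
  have hφ : ∀ x, x ^ Fintype.card F = φ x := fun _ => rfl
  have hiff : twistedFrobenius (AlgebraicClosure F) (Fintype.card F) u = 1 ↔ u = 1 := by
    rw [twistedFrobenius, MonoidHom.coe_mk, OneHom.coe_mk, inv_eq_one, Units.ext_iff, Units.ext_iff,
      Units.val_pow_eq_pow_val, hφ, Units.val_one, map_eq_one_iff _ φ.injective]
  by_cases hu : u = 1
  · simp [splitTorusParam, frobP1, hu]
  · have hu' : twistedFrobenius (AlgebraicClosure F) (Fintype.card F) u ≠ 1 := mt hiff.1 hu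
    have hv : ((twistedFrobenius (AlgebraicClosure F) (Fintype.card F) u : (AlgebraicClosure F)ˣ) :
        AlgebraicClosure F) = (φ u)⁻¹ := by
      rw [← hφ]; simp [twistedFrobenius]
    have h1 := coe_sub_one_ne_zero hu'
    have h2 : φ (u : AlgebraicClosure F) - 1 ≠ 0 := by
      rw [← map_one φ, ← map_sub]
      exact (map_ne_zero φ).2 (coe_sub_one_ne_zero hu)
    have h3 : φ (u : AlgebraicClosure F) ≠ 0 := (map_ne_zero φ).2 u.ne_zero
    rw [splitTorusParam, splitTorusParam, if_neg hu, if_neg hu', frobP1, Option.map_some,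
      Option.some_inj, hφ, map_div₀, map_sub, map_sub, map_mul, map_one, ← hφ t₁, ← hφ t₀, h01, h10,
      div_eq_div_iff h2 h1, hv]
    field_simp
    ring

section
variable {F : Type} [Field F] {γ : Matrix (Fin 2) (Fin 2) F}
  {l l' : AlgebraicClosure F} {ζ : (AlgebraicClosure F)ˣ}

theorem splitTorusParam_moebius (hc : em F (γ 1 0) ≠ 0) (hl0 : l ≠ 0)
    (hsum : l + l' = em F (γ 0 0) + em F (γ 1 1))
    (hprod : l * l' = em F (γ 0 0) * em F (γ 1 1) - em F (γ 0 1) * em F (γ 1 0))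
    (hζ : l * ζ = l') (hζ1 : ζ ≠ 1) (u : (AlgebraicClosure F)ˣ) :
    moebius γ (splitTorusParam ((l - em F (γ 1 1)) / em F (γ 1 0))
        ((l' - em F (γ 1 1)) / em F (γ 1 0)) u) =
      splitTorusParam ((l - em F (γ 1 1)) / em F (γ 1 0))
        ((l' - em F (γ 1 1)) / em F (γ 1 0)) (ζ * u) := by
  have hz := coe_sub_one_ne_zero hζ1
  subst hζ
  have hden : ∀ v : (AlgebraicClosure F)ˣ, v ≠ 1 →
      em F (γ 1 0) * (((l * ζ - em F (γ 1 1)) / em F (γ 1 0) * v -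
        (l - em F (γ 1 1)) / em F (γ 1 0)) / (v - 1)) + em F (γ 1 1) =
        l * (ζ * v - 1) / (v - 1) := fun v hv => by
    have := coe_sub_one_ne_zero hv
    field_simp
    ring
  unfold splitTorusParam
  by_cases hu : u = 1
  · rw [if_pos hu, hu, mul_one, if_neg hζ1, moebius, if_neg fun h => hc (by rw [h, map_zero]),
      Option.some_inj, eq_sub_of_add_eq hsum.symm]
    field_simp
    ring
  · have hu' := coe_sub_one_ne_zero hu
    rw [if_neg hu, moebius, hden u hu]
    by_cases hζu : ζ * u = 1
    · have : (ζ : AlgebraicClosure F) * u = 1 := by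
        rw [← Units.val_mul, hζu, Units.val_one]
      rw [if_pos hζu, if_pos (by rw [this]; simp)]
    · have hζu' := coe_sub_one_ne_zero hζu
      rw [Units.val_mul] at hζu'
      rw [if_neg hζu, if_neg (div_ne_zero (mul_ne_zero hl0 hζu') hu'), Option.some_inj,
        Units.val_mul, div_eq_div_iff (div_ne_zero (mul_ne_zero hl0 hζu') hu') hζu']
      have hb : em F (γ 0 1) =
          ((l + l * ζ - em F (γ 1 1)) * em F (γ 1 1) - l * (l * ζ)) / em F (γ 1 0) := by
        rw [eq_div_iff hc]
        linear_combination hprod - em F (γ 1 1) * hsum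
      rw [hb, eq_sub_of_add_eq hsum.symm]
      field_simp
      ring

theorem pow_eq_smul_one_iff (hc : em F (γ 1 0) ≠ 0) (hl0 : l ≠ 0) (hne : l ≠ l')
    (hsum : l + l' = em F (γ 0 0) + em F (γ 1 1))
    (hprod : l * l' = em F (γ 0 0) * em F (γ 1 1) - em F (γ 0 1) * em F (γ 1 0))
    (hζ : l * ζ = l') (n : ℕ) :
    (∃ x : F, γ ^ n = x • (1 : Matrix (Fin 2) (Fin 2) F)) ↔ ζ ^ n = 1 := by
  have hinj := (em F).injective
  have heig : ∀ (x y : AlgebraicClosure F), x + y = em F (γ 0 0) + em F (γ 1 1) →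
      x * y = em F (γ 0 0) * em F (γ 1 1) - em F (γ 0 1) * em F (γ 1 0) → ∀ n : ℕ,
      em F ((γ ^ n) 0 0) * (x - em F (γ 1 1)) + em F ((γ ^ n) 0 1) * em F (γ 1 0) =
        x ^ n * (x - em F (γ 1 1)) ∧
      em F ((γ ^ n) 1 0) * (x - em F (γ 1 1)) + em F ((γ ^ n) 1 1) * em F (γ 1 0) =
        x ^ n * em F (γ 1 0) := by
    intro x y hs hp n
    induction n with
    | zero => simp
    | succ n ih =>
      obtain ⟨h1, h2⟩ := ih
      simp only [pow_succ, Matrix.mul_apply, Fin.sum_univ_two, map_add, map_mul]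
      have hx : em F (γ 0 0) * (x - em F (γ 1 1)) + em F (γ 0 1) * em F (γ 1 0) =
          x * (x - em F (γ 1 1)) := by linear_combination hp - x * hs
      constructor
      · linear_combination x * h1 + em F ((γ ^ n) 0 0) * hx
      · linear_combination x * h2 + em F ((γ ^ n) 1 0) * hx
  obtain ⟨h1, h2⟩ := heig l l' hsum hprod n
  obtain ⟨h3, h4⟩ := heig l' l (by rw [add_comm, hsum]) (by rw [mul_comm, hprod]) n
  have hζn : ζ ^ n = 1 ↔ l ^ n = l' ^ n := by
    rw [← hζ, mul_pow, left_eq_mul₀ (pow_ne_zero n hl0), Units.ext_iff, Units.val_pow_eq_pow_val,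
      Units.val_one]
  rw [hζn]
  constructor
  · rintro ⟨x, hx⟩
    rw [hx] at h2 h4
    simp only [Matrix.smul_apply, Matrix.one_apply_eq, smul_eq_mul, mul_one, ne_eq, one_ne_zero,
      not_false_eq_true, Matrix.one_apply_ne, mul_zero, map_zero, zero_mul, zero_add] at h2 h4
    exact mul_right_cancel₀ hc (h2.symm.trans h4)
  · intro h
    have h10 : em F ((γ ^ n) 1 0) = 0 := by
      refine (mul_eq_zero.1 (?_ : _ * (l - l') = 0)).resolve_right (sub_ne_zero.2 hne)
      linear_combination h2 - h4 + em F (γ 1 0) * h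
    have h11 : em F ((γ ^ n) 1 1) = l ^ n := mul_right_cancel₀ hc (by rw [← h2, h10]; ring)
    have h00 : em F ((γ ^ n) 0 0) = l ^ n := mul_right_cancel₀ (sub_ne_zero.2 hne) <| by
      linear_combination h1 - h3 + (l' - em F (γ 1 1)) * h
    have h01 : em F ((γ ^ n) 0 1) = 0 := (mul_eq_zero.1 (by
      rw [h00] at h1
      linear_combination h1 : _ * em F (γ 1 0) = 0)).resolve_right hc
    refine ⟨(γ ^ n) 0 0, ?_⟩
    ext i j
    apply hinj
    fin_cases i <;> fin_cases j <;> simp [h10, h11, h00, h01]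

theorem moebius_eq_self_of_eigenvalue (hc : em F (γ 1 0) ≠ 0) (hl0 : l ≠ 0)
    (hsum : l + l' = em F (γ 0 0) + em F (γ 1 1))
    (hprod : l * l' = em F (γ 0 0) * em F (γ 1 1) - em F (γ 0 1) * em F (γ 1 0)) :
    moebius γ (some ((l - em F (γ 1 1)) / em F (γ 1 0))) =
      some ((l - em F (γ 1 1)) / em F (γ 1 0)) := by
  have hden : em F (γ 1 0) * ((l - em F (γ 1 1)) / em F (γ 1 0)) + em F (γ 1 1) = l := by
    field_simp
    ring
  rw [moebius, hden, if_neg hl0, Option.some_inj, div_eq_iff hl0]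
  field_simp
  linear_combination hprod - l * hsum

end

theorem stmt16 {F : Type} [Field F] [Fintype F] (hq : Odd (Fintype.card F))
    (γ : GL (Fin 2) F) (hirr : Irreducible (Matrix.charpoly γ.val))
    (m : ℕ) (hm : IsPGLOrder γ.val m)
    (n : ℕ) (hn : 1 ≤ n) :
    ((Fintype.card F : ℤ) ^ 2 + 1) *
      (Set.ncard {S : Finset (Option (AlgebraicClosure F)) |
          S.card = n * m ∧ (∀ t ∈ S, moebius γ.val t ≠ t) ∧
          S.image (frobP1 F) = S ∧ S.image (moebius γ.val) = S} : ℤ)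
    = ((Fintype.card F : ℤ) + 1) *
        ((Fintype.card F : ℤ) ^ (n + 1) - (Fintype.card F : ℤ) ^ n
            - (-1) ^ ((n + 1) / 2) * (Fintype.card F : ℤ) + (-1) ^ (n / 2)) := by
  have hφinj : Function.Injective fun x : AlgebraicClosure F => x ^ Fintype.card F :=
    (FiniteField.frobeniusAlgHom F (AlgebraicClosure F)).toRingHom.injective
  obtain ⟨hc, l, l', hne, hll', hl'l, hsum, hprod⟩ :=
    exists_eigenvalue_of_irreducible_charpoly (K := AlgebraicClosure F) γ.val hirr
  change l + l' = em F _ + em F _ at hsum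
  change l * l' = em F _ * em F _ - em F _ * em F _ at hprod
  have hcK : em F (γ.val 1 0) ≠ 0 := (map_ne_zero (em F)).2 hc
  have hq0 : Fintype.card F ≠ 0 := Fintype.card_ne_zero
  have hl0 : l ≠ 0 := fun h => hne (by rw [← hll', h, zero_pow hq0])
  have hl'0 : l' ≠ 0 := fun h => hne (by rw [← hl'l, h, zero_pow hq0])
  obtain ⟨ζ, hζ⟩ : ∃ ζ : (AlgebraicClosure F)ˣ, l * ζ = l' :=
    ⟨Units.mk0 (l' / l) (div_ne_zero hl'0 hl0), mul_div_cancel₀ _ hl0⟩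
  have hζ1 : ζ ≠ 1 := fun h => hne (by rw [← hζ, h, Units.val_one, mul_one])
  have hpow := pow_eq_smul_one_iff hcK hl0 hne hsum hprod hζ
  obtain ⟨⟨hm0, hγm⟩, hmin⟩ := hm
  have hord : orderOf ζ = m := by
    rw [orderOf_eq_iff hm0]
    exact ⟨(hpow m).1 hγm, fun i hi hi0 h => (hmin ⟨hi0, (hpow i).2 h⟩).not_gt hi⟩
  have hker : ∀ x : (AlgebraicClosure F)ˣ, x ^ m = 1 → x ∈ Subgroup.zpowers ζ := fun x hx => by
    have : NeZero m := ⟨hm0.ne'⟩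
    rw [IsPrimitiveRoot.zpowers_eq (hord ▸ IsPrimitiveRoot.orderOf ζ : IsPrimitiveRoot ζ m)]
    exact (mem_rootsOfUnity m x).2 hx
  have hsurj : Function.Surjective fun x : (AlgebraicClosure F)ˣ => x ^ m := fun x => by
    obtain ⟨z, hz⟩ := IsAlgClosed.exists_pow_nat_eq (x : AlgebraicClosure F) hm0
    have hz0 : z ≠ 0 := fun h => x.ne_zero (by rw [← hz, h, zero_pow hm0.ne'])
    exact ⟨Units.mk0 z hz0, Units.ext (by simpa using hz)⟩
  have htw : Function.Injective (twistedFrobenius (AlgebraicClosure F) (Fintype.card F)) :=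
    fun x y hxy => Units.ext (hφinj (by simpa using congrArg Units.val (inv_injective hxy)))
  set t₀ := (l - em F (γ.val 1 1)) / em F (γ.val 1 0) with ht₀
  set t₁ := (l' - em F (γ.val 1 1)) / em F (γ.val 1 0) with ht₁
  have ht : t₀ ≠ t₁ := fun h => hne (by
    rw [ht₀, ht₁, div_left_inj' hcK] at h
    exact sub_left_injective h)
  have hφem : ∀ x : F, em F x ^ Fintype.card F = em F x := fun x => by
    rw [← map_pow, FiniteField.pow_card]
  have hφdiv : ∀ x y : AlgebraicClosure F, x ^ Fintype.card F = y →
      ((x - em F (γ.val 1 1)) / em F (γ.val 1 0)) ^ Fintype.card F =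
        (y - em F (γ.val 1 1)) / em F (γ.val 1 0) := fun x y hxy => by
    have h := map_sub (FiniteField.frobeniusAlgHom F (AlgebraicClosure F)) x (em F (γ.val 1 1))
    simp only [FiniteField.frobeniusAlgHom_apply] at h
    rw [div_pow, h, hφem, hφem, hxy]
  have h01 : t₀ ^ Fintype.card F = t₁ := hφdiv l l' hll'
  have h10 : t₁ ^ Fintype.card F = t₀ := hφdiv l' l hl'l
  let V : (AlgebraicClosure F)ˣ ↪ Option (AlgebraicClosure F) :=
    ⟨splitTorusParam t₀ t₁, splitTorusParam_injective ht⟩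
  have hVf : ∀ u, frobP1 F (V u) = V (twistedFrobenius _ (Fintype.card F) u) :=
    splitTorusParam_frobP1 h01 h10
  have hVm : ∀ u, moebius γ.val (V u) = V (ζ * u) :=
    splitTorusParam_moebius hcK hl0 hsum hprod hζ hζ1
  have hrange : ∀ t, t ∈ Set.range V ↔ t ≠ some t₀ ∧ t ≠ some t₁ :=
    mem_range_splitTorusParam ht
  have hfix : ∀ t, moebius γ.val t ≠ t ↔ t ∈ Set.range V := by
    intro t
    constructor
    · intro h
      rw [hrange]
      refine ⟨?_, ?_⟩
      · rintro rfl
        exact h (moebius_eq_self_of_eigenvalue hcK hl0 hsum hprod)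
      · rintro rfl
        exact h (moebius_eq_self_of_eigenvalue hcK hl'0 (by rw [add_comm, hsum])
          (by rw [mul_comm, hprod]))
    · rintro ⟨u, rfl⟩ h
      rw [hVm] at h
      exact hζ1 (mul_eq_right.1 (V.injective h))
  have hfinj : Function.Injective (frobP1 F) := Option.map_injective hφinj
  let Y : ℕ → Set (Finset (Option (AlgebraicClosure F))) := fun i =>
    {S | S.card = i ∧ S.image (frobP1 F) = S ∧ Disjoint {some t₀, some t₁} S}
  have hX : {S : Finset (Option (AlgebraicClosure F)) |
      S.card = n * m ∧ (∀ t ∈ S, moebius γ.val t ≠ t) ∧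
      S.image (frobP1 F) = S ∧ S.image (moebius γ.val) = S}.encard = (Y n).encard := by
    have h1 := encard_stable_map V hVf hVm (n * m)
    have h2 := encard_stable_map V hVf (g := id) (g' := id) (fun _ => rfl) n
    simp only [Finset.image_id, and_true] at h2
    simp only [hfix]
    rw [h1, encard_stable_quotient hm0 hord hker hsurj _ htw, ← h2]
    congr 1
    ext S
    simp only [Y, Set.mem_ofPred_eq, hrange, Finset.disjoint_insert_left,
      Finset.disjoint_singleton_left]
    have : (∀ t ∈ S, t ≠ some t₀ ∧ t ≠ some t₁) ↔ some t₀ ∉ S ∧ some t₁ ∉ S :=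
      ⟨fun h => ⟨fun h' => (h _ h').1 rfl, fun h' => (h _ h').2 rfl⟩, fun h t ht =>
        ⟨fun h' => h.1 (h' ▸ ht), fun h' => h.2 (h' ▸ ht)⟩⟩
    rw [this]
    tauto
  have hpair : ({some t₀, some t₁} : Finset (Option (AlgebraicClosure F))).card = 2 :=
    Finset.card_pair fun h => ht (Option.some_injective _ h)
  have hf0 : frobP1 F (some t₀) = some t₁ := congrArg some h01
  have hf1 : frobP1 F (some t₁) = some t₀ := congrArg some h10
  have hdich : ∀ S : Finset (Option (AlgebraicClosure F)), S.image (frobP1 F) = S →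
      {some t₀, some t₁} ⊆ S ∨ Disjoint {some t₀, some t₁} S := by
    intro S hS
    have hmem : ∀ t ∈ S, frobP1 F t ∈ S := fun t h => hS ▸ Finset.mem_image_of_mem _ h
    have h0 : some t₀ ∈ S → some t₁ ∈ S := fun h => hf0 ▸ hmem _ h
    have h1 : some t₁ ∈ S → some t₀ ∈ S := fun h => hf1 ▸ hmem _ h
    simp only [Finset.insert_subset_iff, Finset.singleton_subset_iff, Finset.disjoint_insert_left,
      Finset.disjoint_singleton_left]
    tauto
  let s : ℕ → ℕ := fun i => {f : F[X] | f.Monic ∧ f.natDegree = i ∧ Squarefree f}.ncard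
  have hR : ∀ i, {S : Finset (Option (AlgebraicClosure F)) | S.card = i + 1 ∧
      S.image (frobP1 F) = S}.encard = ((s (i + 1) + s i : ℕ) : ℕ∞) :=
    encard_frobenius_stable_option
  have hYsum : ∀ i, (Y (i + 2)).encard + (Y i).encard = ((s (i + 2) + s (i + 1) : ℕ) : ℕ∞) := by
    intro i
    have h := encard_stable_split hfinj (O := {some t₀, some t₁}) (Finset.insert_nonempty _ _)
      (by rw [Finset.image_insert, Finset.image_singleton, hf0, hf1, Finset.pair_comm]) hdich i
    rw [hpair] at h
    rw [← hR (i + 1)]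
    exact h.symm
  have hYfin : ∀ i, (Y i).Finite := fun i => by
    rw [← Set.encard_ne_top_iff]
    exact ne_top_of_le_ne_top (hYsum i ▸ ENat.natCast_ne_top _) le_add_self
  have hY0 : (Y 0).ncard = 1 := by
    rw [Set.ncard_eq_one]
    refine ⟨∅, Set.ext fun S => ⟨fun h => Finset.card_eq_zero.1 h.1, ?_⟩⟩
    rintro rfl
    exact ⟨rfl, rfl, Finset.disjoint_empty_right _⟩
  have hY1 : (Y 1).ncard = s 1 + s 0 := by
    have h := hR 0
    rw [← Nat.cast_inj (R := ℕ∞), (hYfin 1).cast_ncard_eq, ← h]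
    congr 1
    ext S
    refine ⟨fun h => ⟨h.1, h.2.1⟩, fun h => ⟨h.1, h.2, (hdich S h.2).resolve_left fun hs => ?_⟩⟩
    have := Finset.card_le_card hs
    rw [hpair, h.1] at this
    omega
  have hYrec : ∀ i, (Y (i + 2)).ncard + (Y i).ncard = s (i + 2) + s (i + 1) := fun i => by
    have h := hYsum i
    rw [← (hYfin _).cast_ncard_eq, ← (hYfin _).cast_ncard_eq] at h
    exact_mod_cast h
  obtain ⟨n, rfl⟩ := Nat.exists_eq_add_of_le' hn
  rw [Set.ncard, hX, ← Set.ncard]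
  exact count_of_recursion (s := s) (y := fun i => (Y i).ncard) ncard_squarefree_zero
    ncard_squarefree_one ncard_squarefree_add_two hY0 hY1 hYrec n

end Hyp
end
end
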